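/- arXiv:2008.08524 — 9 statements merged into one kernel-verified Lean document; each statement's English description precedes it below -/
import Mathlib

section
/- Let X and Y be nonempty finite types, let k be a positive natural number, let f : X → Fin k be surjective, and let θ : Fin k → ℝ, p : Fin k → X → ℝ, q : Fin k → Y → ℝ be nonnegative functions. Then the maximum over all pairs (x,y) ∈ X × Y of θ(f x) · p(f x)(x) · q(f x)(y) equals the maximum over i ∈ Fin k of θ(i) · (the maximum of p(i)(x) over all x ∈ X with f x = i) · (the maximum of q(i)(y) over all y ∈ Y). -/
theorem stmt_0 {X Y : Type*} [Fintype X] [Fintype Y] [Nonempty X] [Nonempty Y]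
    (k : ℕ) (hk : 0 < k) (f : X → Fin k) (hf : Function.Surjective f)
    (θ : Fin k → ℝ) (p : Fin k → X → ℝ) (q : Fin k → Y → ℝ)
    (hθ : ∀ i, 0 ≤ θ i) (hp : ∀ i x, 0 ≤ p i x) (hq : ∀ i y, 0 ≤ q i y) :
    (⨆ xy : X × Y, θ (f xy.1) * p (f xy.1) xy.1 * q (f xy.1) xy.2)
      = ⨆ i : Fin k, θ i * (⨆ x : {x : X // f x = i}, p i (x : X)) * ⨆ y : Y, q i y := by
  have : Nonempty (Fin k) := ⟨⟨0, hk⟩⟩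
  apply le_antisymm
  · refine ciSup_le fun ⟨x, y⟩ => ?_
    refine le_trans ?_ (le_ciSup (Set.finite_range _).bddAbove (f x))
    have hpx : p (f x) x ≤ ⨆ x' : {x' : X // f x' = f x}, p (f x) (x' : X) :=
      le_ciSup (f := fun x' : {x' : X // f x' = f x} => p (f x) (x' : X))
        (Set.finite_range _).bddAbove ⟨x, rfl⟩
    have hqy : q (f x) y ≤ ⨆ y' : Y, q (f x) y' :=
      le_ciSup (Set.finite_range _).bddAbove y
    exact mul_le_mul (mul_le_mul_of_nonneg_left hpx (hθ _)) hqy (hq _ _)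
      (mul_nonneg (hθ _) ((hp _ _).trans hpx))
  · refine ciSup_le fun i => ?_
    obtain ⟨x₀, hx₀⟩ := hf i
    have : Nonempty {x : X // f x = i} := ⟨⟨x₀, hx₀⟩⟩
    obtain ⟨⟨x, rfl⟩, hx⟩ := exists_eq_ciSup_of_finite
      (f := fun x : {x : X // f x = i} => p i (x : X))
    obtain ⟨y, hy⟩ := exists_eq_ciSup_of_finite (f := q (f x))
    rw [← hx, ← hy]
    exact le_ciSup (f := fun xy : X × Y => θ (f xy.1) * p (f xy.1) xy.1 * q (f xy.1) xy.2)
      (Set.finite_range _).bddAbove (x, y)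
end

section
/- Let X and Y be finite types, k a natural number, f : X → Fin k, θ : Fin k → ℝ with θ i ≥ 0 for all i and ∑ i, θ i = 1, p : Fin k → X → ℝ such that each p i is a PMF on X and p i x = 0 whenever f x ≠ i, and q : Fin k → Y → ℝ such that each q i is a PMF on Y, and let P(x,y) := θ(f x) · p(f x)(x) · q(f x)(y) be the decision-node mixture. Then for every j ∈ Fin k, the total mass of the event {(x,y) : f x = j} under P equals θ(j); consequently, if θ(j) > 0, then for every x with f x = j and every y, the conditional mass P(x,y) / θ(j) equals p(j)(x) · q(j)(y). -/
/-- A probability mass function on a finite type: nonnegative and summing to one. -/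
def IsPMF {Z : Type*} [Fintype Z] (g : Z → ℝ) : Prop :=
  (∀ z, 0 ≤ g z) ∧ ∑ z, g z = 1

theorem stmt_3 {X Y : Type*} [Fintype X] [Fintype Y]
    (k : ℕ) (f : X → Fin k) (θ : Fin k → ℝ)
    (hθ : ∀ i, 0 ≤ θ i) (hθsum : ∑ i, θ i = 1)
    (p : Fin k → X → ℝ) (hp : ∀ i, IsPMF (p i))
    (hsupp : ∀ i x, f x ≠ i → p i x = 0)
    (q : Fin k → Y → ℝ) (hq : ∀ i, IsPMF (q i))
    (j : Fin k) :
    (∑ xy ∈ Finset.univ.filter (fun xy : X × Y => f xy.1 = j),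
        θ (f xy.1) * p (f xy.1) xy.1 * q (f xy.1) xy.2) = θ j ∧
    (0 < θ j → ∀ x : X, f x = j → ∀ y : Y,
        (θ (f x) * p (f x) x * q (f x) y) / θ j = p j x * q j y) := by
  constructor
  · have mass_eq : ∀ x y, (if f x = j then θ (f x) * p (f x) x * q (f x) y else 0) =
        θ j * p j x * q j y := by
      intro x y
      split_ifs with h
      · rw [h]
      · simp [hsupp j x h]
    rw [Finset.sum_filter, Fintype.sum_prod_type]
    simp only [mass_eq, ← Finset.mul_sum, (hq j).2, (hp j).2, mul_one]
  · rintro hj x rfl y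
    field_simp
end

section
/- Let k be a natural number, let K be a nonempty subset of the standard simplex Δ_k = {θ : Fin k → ℝ | (∀ i, θ i ≥ 0) ∧ ∑ i, θ i = 1}, and for each i ∈ Fin k let A i and B i be nonempty subsets of the interval [0,1]. Then the infimum, over all θ ∈ K and all choices a i ∈ A i and b i ∈ B i (for each i), of ∑ i, θ i · a i · b i equals the infimum over θ ∈ K of ∑ i, θ i · (inf of A i) · (inf of B i). -/
/-- For subsets of `[0, 1]`, the product of the infima is approximated by products of elements. -/
theorem exists_mul_lt_sInf_mul_sInf_add {S T : Set ℝ} (hS : S.Nonempty) (hS' : S ⊆ Set.Icc 0 1)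
    (hT : T.Nonempty) (hT' : T ⊆ Set.Icc 0 1) {ε : ℝ} (hε : 0 < ε) :
    ∃ s ∈ S, ∃ t ∈ T, s * t < sInf S * sInf T + ε := by
  obtain ⟨s, hs, hsε⟩ := Real.lt_sInf_add_pos hS (half_pos hε)
  obtain ⟨t, ht, htε⟩ := Real.lt_sInf_add_pos hT (half_pos hε)
  have hs₀ : sInf S ≤ s := csInf_le ⟨0, fun x hx => (hS' hx).1⟩ hs
  have ht₁ : sInf T ≤ t := csInf_le ⟨0, fun x hx => (hT' hx).1⟩ ht
  have hs₁ : s ≤ 1 := (hS' hs).2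
  have ht₂ : t ≤ 1 := (hT' ht).2
  refine ⟨s, hs, t, ht, ?_⟩
  nlinarith [mul_nonneg (sub_nonneg.2 hs₁) (sub_nonneg.2 ht₁),
    mul_nonneg (sub_nonneg.2 hs₀) (sub_nonneg.2 (ht₁.trans ht₂))]

theorem stmt_4 (k : ℕ) (K : Set (Fin k → ℝ))
    (hK : K ⊆ {θ : Fin k → ℝ | (∀ i, 0 ≤ θ i) ∧ ∑ i, θ i = 1})
    (hKne : K.Nonempty)
    (A B : Fin k → Set ℝ)
    (hA : ∀ i, (A i).Nonempty) (hA' : ∀ i, A i ⊆ Set.Icc 0 1)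
    (hB : ∀ i, (B i).Nonempty) (hB' : ∀ i, B i ⊆ Set.Icc 0 1) :
    sInf {v : ℝ | ∃ θ ∈ K, ∃ a b : Fin k → ℝ,
        (∀ i, a i ∈ A i) ∧ (∀ i, b i ∈ B i) ∧ v = ∑ i, θ i * a i * b i}
      = sInf {v : ℝ | ∃ θ ∈ K, v = ∑ i, θ i * sInf (A i) * sInf (B i)} := by
  have hA₀ : ∀ i, 0 ≤ sInf (A i) := fun i => Real.sInf_nonneg fun x hx => (hA' i hx).1
  have hB₀ : ∀ i, 0 ≤ sInf (B i) := fun i => Real.sInf_nonneg fun x hx => (hB' i hx).1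
  obtain ⟨θ₀, hθ₀⟩ := hKne
  choose a₀ ha₀ using hA
  choose b₀ hb₀ using hB
  apply le_antisymm
  · refine le_csInf ⟨_, θ₀, hθ₀, rfl⟩ ?_
    rintro _ ⟨θ, hθ, rfl⟩
    refine le_of_forall_pos_le_add fun ε hε => ?_
    choose a ha b hb hab using fun i =>
      exists_mul_lt_sInf_mul_sInf_add ⟨a₀ i, ha₀ i⟩ (hA' i) ⟨b₀ i, hb₀ i⟩ (hB' i) hε
    refine le_trans (csInf_le ⟨0, ?_⟩ ⟨θ, hθ, a, b, ha, hb, rfl⟩) ?_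
    · rintro _ ⟨η, hη, c, d, hc, hd, rfl⟩
      exact Finset.sum_nonneg fun i _ =>
        mul_nonneg (mul_nonneg ((hK hη).1 i) (hA' i (hc i)).1) (hB' i (hd i)).1
    · calc ∑ i, θ i * a i * b i
          ≤ ∑ i, (θ i * sInf (A i) * sInf (B i) + θ i * ε) := by
            refine Finset.sum_le_sum fun i _ => ?_
            linarith [mul_le_mul_of_nonneg_left (hab i).le ((hK hθ).1 i)]
        _ = ∑ i, θ i * sInf (A i) * sInf (B i) + ε := by
            rw [Finset.sum_add_distrib, ← Finset.sum_mul, (hK hθ).2, one_mul]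
  · refine le_csInf ⟨_, θ₀, hθ₀, a₀, b₀, ha₀, hb₀, rfl⟩ ?_
    rintro _ ⟨θ, hθ, a, b, ha, hb, rfl⟩
    refine le_trans (csInf_le ⟨0, ?_⟩ ⟨θ, hθ, rfl⟩) ?_
    · rintro _ ⟨η, hη, rfl⟩
      exact Finset.sum_nonneg fun i _ =>
        mul_nonneg (mul_nonneg ((hK hη).1 i) (hA₀ i)) (hB₀ i)
    · refine Finset.sum_le_sum fun i _ => ?_
      have hai : sInf (A i) ≤ a i := csInf_le ⟨0, fun x hx => (hA' i hx).1⟩ (ha i)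
      have hbi : sInf (B i) ≤ b i := csInf_le ⟨0, fun x hx => (hB' i hx).1⟩ (hb i)
      have hθi := (hK hθ).1 i
      exact mul_le_mul (mul_le_mul_of_nonneg_left hai hθi) hbi (hB₀ i)
        (mul_nonneg hθi (hA' i (ha i)).1)
end

section
/- Let A be a nonempty compact subset of ℝ and let B be a nonempty compact subset of [0,∞). Then the infimum of {a · b | a ∈ A, b ∈ B} equals (inf A) · (sup B) if inf A < 0, and equals (inf A) · (inf B) otherwise. -/
theorem stmt_6 (A B : Set ℝ)
    (hAne : A.Nonempty) (hAc : IsCompact A)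
    (hBne : B.Nonempty) (hBc : IsCompact B) (hB : B ⊆ Set.Ici 0) :
    sInf {x : ℝ | ∃ a ∈ A, ∃ b ∈ B, x = a * b}
      = if sInf A < 0 then sInf A * sSup B else sInf A * sInf B := by
  have hA := hAc.isLeast_sInf hAne
  split_ifs with h
  · refine IsLeast.csInf_eq ⟨⟨_, hA.1, _, hBc.sSup_mem hBne, rfl⟩, ?_⟩
    rintro _ ⟨a, ha, b, hb, rfl⟩
    calc sInf A * sSup B ≤ sInf A * b :=
          mul_le_mul_of_nonpos_left (le_csSup hBc.bddAbove hb) h.le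
      _ ≤ a * b := mul_le_mul_of_nonneg_right (hA.2 ha) (hB hb)
  · refine IsLeast.csInf_eq ⟨⟨_, hA.1, _, hBc.sInf_mem hBne, rfl⟩, ?_⟩
    rintro _ ⟨a, ha, b, hb, rfl⟩
    calc sInf A * sInf B ≤ sInf A * b :=
          mul_le_mul_of_nonneg_left (csInf_le hBc.bddBelow hb) (not_lt.mp h)
      _ ≤ a * b := mul_le_mul_of_nonneg_right (hA.2 ha) (hB hb)
end

section
/- Let k be a natural number, let K be a nonempty subset of the standard simplex Δ_k = {θ : Fin k → ℝ | (∀ i, θ i ≥ 0) ∧ ∑ i, θ i = 1}, and for each i ∈ Fin k let A i be a nonempty compact subset of ℝ and B i a nonempty compact subset of [0,∞). For each i define c i := (inf of A i) · (sup of B i) if inf of A i < 0, and c i := (inf of A i) · (inf of B i) otherwise. Then the infimum, over all θ ∈ K and all choices a i ∈ A i and b i ∈ B i (for each i), of ∑ i, θ i · a i · b i equals the infimum over θ ∈ K of ∑ i, θ i · c i. -/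
/-- The least value of a product `a * b` with `a` in a compact set `A` and `b` in a compact set `B`
of nonnegative reals. -/
theorem isLeast_image2_mul {A B : Set ℝ} (hAne : A.Nonempty) (hAc : IsCompact A)
    (hBne : B.Nonempty) (hBc : IsCompact B) (hB : B ⊆ Set.Ici 0) :
    IsLeast (Set.image2 (· * ·) A B)
      (if sInf A < 0 then sInf A * sSup B else sInf A * sInf B) := by
  split_ifs with h
  · refine ⟨⟨_, hAc.sInf_mem hAne, _, hBc.sSup_mem hBne, rfl⟩, ?_⟩
    rintro _ ⟨a, ha, b, hb, rfl⟩
    calc sInf A * sSup B ≤ sInf A * b :=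
          mul_le_mul_of_nonpos_left (le_csSup hBc.bddAbove hb) h.le
      _ ≤ a * b := mul_le_mul_of_nonneg_right (csInf_le hAc.bddBelow ha) (hB hb)
  · refine ⟨⟨_, hAc.sInf_mem hAne, _, hBc.sInf_mem hBne, rfl⟩, ?_⟩
    rintro _ ⟨a, ha, b, hb, rfl⟩
    calc sInf A * sInf B ≤ sInf A * b :=
          mul_le_mul_of_nonneg_left (csInf_le hBc.bddBelow hb) (not_lt.mp h)
      _ ≤ a * b := mul_le_mul_of_nonneg_right (csInf_le hAc.bddBelow ha) (hB hb)

/-- A linear functional is bounded below on every subset of the standard simplex. -/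
theorem bddBelow_sum_mul_of_subset_simplex {ι : Type*} [Fintype ι] {K : Set (ι → ℝ)}
    (hK : K ⊆ {θ : ι → ℝ | (∀ i, 0 ≤ θ i) ∧ ∑ i, θ i = 1}) (c : ι → ℝ) :
    BddBelow {v : ℝ | ∃ θ ∈ K, v = ∑ i, θ i * c i} := by
  refine ⟨-∑ i, |c i|, ?_⟩
  rintro _ ⟨θ, hθ, rfl⟩
  obtain ⟨hnonneg, hsum⟩ := hK hθ
  rw [← Finset.sum_neg_distrib]
  refine Finset.sum_le_sum fun i _ => ?_
  have hle : θ i ≤ 1 :=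
    hsum ▸ Finset.single_le_sum (fun j _ => hnonneg j) (Finset.mem_univ i)
  calc -|c i| ≤ -|θ i * c i| := by
        rw [abs_mul, abs_of_nonneg (hnonneg i)]
        exact neg_le_neg (mul_le_of_le_one_left (abs_nonneg _) hle)
    _ ≤ θ i * c i := neg_abs_le _

theorem stmt_7 (k : ℕ) (K : Set (Fin k → ℝ))
    (hK : K ⊆ {θ : Fin k → ℝ | (∀ i, 0 ≤ θ i) ∧ ∑ i, θ i = 1})
    (hKne : K.Nonempty)
    (A B : Fin k → Set ℝ)
    (hAne : ∀ i, (A i).Nonempty) (hAc : ∀ i, IsCompact (A i))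
    (hBne : ∀ i, (B i).Nonempty) (hBc : ∀ i, IsCompact (B i))
    (hB : ∀ i, B i ⊆ Set.Ici 0)
    (c : Fin k → ℝ)
    (hc : ∀ i, c i = if sInf (A i) < 0 then sInf (A i) * sSup (B i)
                     else sInf (A i) * sInf (B i)) :
    sInf {v : ℝ | ∃ θ ∈ K, ∃ a b : Fin k → ℝ,
        (∀ i, a i ∈ A i) ∧ (∀ i, b i ∈ B i) ∧ v = ∑ i, θ i * a i * b i}
      = sInf {v : ℝ | ∃ θ ∈ K, v = ∑ i, θ i * c i} := by
  have hleast : ∀ i, IsLeast (Set.image2 (· * ·) (A i) (B i)) (c i) := fun i =>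
    hc i ▸ isLeast_image2_mul (hAne i) (hAc i) (hBne i) (hBc i) (hB i)
  have hbdd := bddBelow_sum_mul_of_subset_simplex hK c
  obtain ⟨θ₀, hθ₀⟩ := hKne
  choose a ha b hb hab using fun i => (hleast i).1
  have hsub : {v : ℝ | ∃ θ ∈ K, v = ∑ i, θ i * c i} ⊆
      {v : ℝ | ∃ θ ∈ K, ∃ a b : Fin k → ℝ,
        (∀ i, a i ∈ A i) ∧ (∀ i, b i ∈ B i) ∧ v = ∑ i, θ i * a i * b i} := by
    rintro _ ⟨θ, hθ, rfl⟩
    exact ⟨θ, hθ, a, b, ha, hb, Finset.sum_congr rfl fun i _ => by rw [← hab i, mul_assoc]⟩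
  have hne : {v : ℝ | ∃ θ ∈ K, v = ∑ i, θ i * c i}.Nonempty := ⟨_, θ₀, hθ₀, rfl⟩
  have hle : ∀ v ∈ {v : ℝ | ∃ θ ∈ K, ∃ a b : Fin k → ℝ,
        (∀ i, a i ∈ A i) ∧ (∀ i, b i ∈ B i) ∧ v = ∑ i, θ i * a i * b i},
      sInf {v : ℝ | ∃ θ ∈ K, v = ∑ i, θ i * c i} ≤ v := by
    rintro _ ⟨θ, hθ, a', b', ha', hb', rfl⟩
    refine (csInf_le hbdd ⟨θ, hθ, rfl⟩).trans (Finset.sum_le_sum fun i _ => ?_)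
    rw [mul_assoc]
    exact mul_le_mul_of_nonneg_left
      ((hleast i).2 (Set.mem_image2_of_mem (ha' i) (hb' i))) ((hK hθ).1 i)
  exact le_antisymm (csInf_le_csInf ⟨_, hle⟩ hne hsub) (le_csInf (hne.mono hsub) hle)
end

section
/- Let S be a nonempty compact subset of ℝ × ℝ such that every (a,b) ∈ S satisfies a ≥ 0, b ≥ 0, and a + b > 0, and let μ be a real number. Then the infimum of {(1 − μ)·a − μ·b | (a,b) ∈ S} is strictly positive if and only if the infimum of {a / (a + b) | (a,b) ∈ S} is strictly greater than μ. -/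
theorem IsCompact.lt_sInf_setOf_exists_eq_iff {X : Type*} [TopologicalSpace X] {S : Set X}
    (hSc : IsCompact S) (hSne : S.Nonempty) {f : X → ℝ} (hf : ContinuousOn f S) (c : ℝ) :
    c < sInf {v : ℝ | ∃ p ∈ S, v = f p} ↔ ∀ p ∈ S, c < f p := by
  have himage : {v : ℝ | ∃ p ∈ S, v = f p} = f '' S := by
    ext v
    simp only [Set.mem_ofPred_eq, Set.mem_image, eq_comm]
  rw [himage, hSc.lt_sInf_iff_of_continuous hSne hf]

theorem stmt_8 (S : Set (ℝ × ℝ)) (hSne : S.Nonempty) (hSc : IsCompact S)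
    (hS : ∀ p ∈ S, 0 ≤ p.1 ∧ 0 ≤ p.2 ∧ 0 < p.1 + p.2) (μ : ℝ) :
    0 < sInf {v : ℝ | ∃ p ∈ S, v = (1 - μ) * p.1 - μ * p.2}
      ↔ μ < sInf {v : ℝ | ∃ p ∈ S, v = p.1 / (p.1 + p.2)} := by
  have hlin : ContinuousOn (fun p : ℝ × ℝ => (1 - μ) * p.1 - μ * p.2) S := by fun_prop
  have hdiv : ContinuousOn (fun p : ℝ × ℝ => p.1 / (p.1 + p.2)) S :=
    ContinuousOn.div (by fun_prop) (by fun_prop) fun p hp => (hS p hp).2.2.ne'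
  rw [hSc.lt_sInf_setOf_exists_eq_iff hSne hlin, hSc.lt_sInf_setOf_exists_eq_iff hSne hdiv]
  refine forall₂_congr fun p hp => ?_
  rw [lt_div_iff₀ (hS p hp).2.2]
  constructor <;> intro h <;> linarith
end

section
/- Let S be a nonempty compact subset of ℝ × ℝ such that every (a,b) ∈ S satisfies a + b > 0, and define g : ℝ → ℝ by g(μ) := inf of {(1 − μ)·a − μ·b | (a,b) ∈ S}. Then g is strictly decreasing on ℝ. -/
theorem stmt_9 (S : Set (ℝ × ℝ)) (hSne : S.Nonempty) (hSc : IsCompact S)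
    (hS : ∀ p ∈ S, 0 < p.1 + p.2) :
    StrictAnti (fun μ : ℝ => sInf {v : ℝ | ∃ p ∈ S, v = (1 - μ) * p.1 - μ * p.2}) := by
  have exists_isLeast (μ : ℝ) : ∃ p ∈ S,
      IsLeast {v : ℝ | ∃ p ∈ S, v = (1 - μ) * p.1 - μ * p.2} ((1 - μ) * p.1 - μ * p.2) := by
    obtain ⟨p, hp, hmin⟩ := hSc.exists_isMinOn hSne
      (f := fun p : ℝ × ℝ => (1 - μ) * p.1 - μ * p.2) (by fun_prop)
    refine ⟨p, hp, ⟨p, hp, rfl⟩, ?_⟩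
    rintro _ ⟨q, hq, rfl⟩
    exact hmin hq
  intro x y hxy
  obtain ⟨p, hp, hpx⟩ := exists_isLeast x
  obtain ⟨q, -, hqy⟩ := exists_isLeast y
  simp only [hpx.csInf_eq, hqy.csInf_eq]
  have hle := hqy.2 ⟨p, hp, rfl⟩
  nlinarith [mul_pos (sub_pos.2 hxy) (hS p hp)]
end

section
/- Let S be a nonempty compact subset of ℝ × ℝ such that every (a,b) ∈ S satisfies a ≥ 0, b ≥ 0, and a + b > 0, and define g : ℝ → ℝ by g(μ) := inf of {(1 − μ)·a − μ·b | (a,b) ∈ S}, and let μ* := inf of {a / (a + b) | (a,b) ∈ S}. Then for every real μ, g(μ) = 0 if and only if μ = μ*. -/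
theorem IsCompact.exists_sInf_eq_of_continuousOn {α : Type*} [TopologicalSpace α] {S : Set α}
    (hSc : IsCompact S) (hSne : S.Nonempty) {f : α → ℝ} (hf : ContinuousOn f S) :
    ∃ p ∈ S, sInf {v : ℝ | ∃ q ∈ S, v = f q} = f p ∧ ∀ q ∈ S, f p ≤ f q := by
  obtain ⟨p, hp, hmin⟩ := hSc.exists_isMinOn hSne hf
  refine ⟨p, hp, IsLeast.csInf_eq ⟨⟨p, hp, rfl⟩, ?_⟩, fun q hq => hmin hq⟩
  rintro v ⟨q, hq, rfl⟩
  exact hmin hq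

theorem stmt_10 (S : Set (ℝ × ℝ)) (hSne : S.Nonempty) (hSc : IsCompact S)
    (hS : ∀ p ∈ S, 0 ≤ p.1 ∧ 0 ≤ p.2 ∧ 0 < p.1 + p.2) (μ : ℝ) :
    sInf {v : ℝ | ∃ p ∈ S, v = (1 - μ) * p.1 - μ * p.2} = 0
      ↔ μ = sInf {v : ℝ | ∃ p ∈ S, v = p.1 / (p.1 + p.2)} := by
  have hpos : ∀ p ∈ S, 0 < p.1 + p.2 := fun p hp => (hS p hp).2.2
  obtain ⟨p, hp, hfp, hpmin⟩ := hSc.exists_sInf_eq_of_continuousOn hSne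
    (f := fun p : ℝ × ℝ => (1 - μ) * p.1 - μ * p.2) (by fun_prop)
  obtain ⟨q, hq, hrq, hqmin⟩ := hSc.exists_sInf_eq_of_continuousOn hSne
    (f := fun p : ℝ × ℝ => p.1 / (p.1 + p.2))
    (ContinuousOn.div (by fun_prop) (by fun_prop) fun p hp => (hpos p hp).ne')
  rw [hfp, hrq]
  have hpq := hpmin q hq
  have hqp := hqmin p hp
  constructor
  · intro h
    apply le_antisymm
    · rw [le_div_iff₀ (hpos q hq)]
      linarith
    · refine hqp.trans ?_
      rw [div_le_iff₀ (hpos p hp)]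
      linarith
  · intro h
    rw [← h, le_div_iff₀ (hpos p hp)] at hqp
    rw [eq_div_iff (hpos q hq).ne'] at h
    linarith
end

section
/- Let θ₁, θ₂, θ₃, θ₄, θ₅, θ₆, θ₇ be real numbers, each in [0,1], with θ₁ + θ₂ ≤ 1. Define F : Bool⁴ → ℝ on a configuration (x₁,x₂,x₃,x₄) (writing [φ] for the indicator that equals 1 if φ holds and 0 otherwise) by F := θ₁·[¬x₁]·[¬x₂]·(θ₃·[¬x₃]·[x₄] + (1−θ₃)·[x₃]·(θ₆·[x₄] + (1−θ₆)·[¬x₄])) + θ₂·(θ₄·[x₁]·[¬x₂] + (1−θ₄)·[¬x₁]·[x₂])·(θ₅·[x₃]·[¬x₄] + (1−θ₅)·[¬x₃]·(θ₇·[x₄] + (1−θ₇)·[¬x₄])) + (1−θ₁−θ₂)·[x₁]·[x₂]·[¬x₃]·[¬x₄]. Then F is nonnegative and ∑ over all 16 configurations of F equals 1; moreover, if additionally every θᵢ lies in the open interval (0,1) and θ₁ + θ₂ < 1, then F(x₁,x₂,x₃,x₄) > 0 if and only if (x₁ ∨ x₂ ∨ x₃ ∨ x₄) ∧ (there exist distinct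 indices i ≠ j in {1,2,3,4} with ¬x_i ∧ ¬x_j). -/
/-- Indicator of a Boolean: `1` if true, `0` otherwise. -/
def ind (b : Bool) : ℝ := if b then 1 else 0

lemma ind_true : ind true = 1 := rfl

lemma ind_false : ind false = 0 := rfl

theorem stmt_17 (θ₁ θ₂ θ₃ θ₄ θ₅ θ₆ θ₇ : ℝ)
    (h₁ : θ₁ ∈ Set.Icc (0 : ℝ) 1) (h₂ : θ₂ ∈ Set.Icc (0 : ℝ) 1)
    (h₃ : θ₃ ∈ Set.Icc (0 : ℝ) 1) (h₄ : θ₄ ∈ Set.Icc (0 : ℝ) 1)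
    (h₅ : θ₅ ∈ Set.Icc (0 : ℝ) 1) (h₆ : θ₆ ∈ Set.Icc (0 : ℝ) 1)
    (h₇ : θ₇ ∈ Set.Icc (0 : ℝ) 1) (h₁₂ : θ₁ + θ₂ ≤ 1)
    (F : Bool → Bool → Bool → Bool → ℝ)
    (hF : ∀ x₁ x₂ x₃ x₄ : Bool, F x₁ x₂ x₃ x₄ =
      θ₁ * ind (!x₁) * ind (!x₂) *
          (θ₃ * ind (!x₃) * ind x₄ +
            (1 - θ₃) * ind x₃ * (θ₆ * ind x₄ + (1 - θ₆) * ind (!x₄))) +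
      θ₂ * (θ₄ * ind x₁ * ind (!x₂) + (1 - θ₄) * ind (!x₁) * ind x₂) *
          (θ₅ * ind x₃ * ind (!x₄) +
            (1 - θ₅) * ind (!x₃) * (θ₇ * ind x₄ + (1 - θ₇) * ind (!x₄))) +
      (1 - θ₁ - θ₂) * ind x₁ * ind x₂ * ind (!x₃) * ind (!x₄)) :
    (∀ x₁ x₂ x₃ x₄ : Bool, 0 ≤ F x₁ x₂ x₃ x₄) ∧
    (∑ x₁ : Bool, ∑ x₂ : Bool, ∑ x₃ : Bool, ∑ x₄ : Bool, F x₁ x₂ x₃ x₄) = 1 ∧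
    ((θ₁ ∈ Set.Ioo (0 : ℝ) 1 ∧ θ₂ ∈ Set.Ioo (0 : ℝ) 1 ∧ θ₃ ∈ Set.Ioo (0 : ℝ) 1 ∧
        θ₄ ∈ Set.Ioo (0 : ℝ) 1 ∧ θ₅ ∈ Set.Ioo (0 : ℝ) 1 ∧ θ₆ ∈ Set.Ioo (0 : ℝ) 1 ∧
        θ₇ ∈ Set.Ioo (0 : ℝ) 1 ∧ θ₁ + θ₂ < 1) →
      ∀ x₁ x₂ x₃ x₄ : Bool,
        0 < F x₁ x₂ x₃ x₄ ↔
          ((x₁ = true ∨ x₂ = true ∨ x₃ = true ∨ x₄ = true) ∧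
            ∃ i j : Fin 4, i ≠ j ∧
              ![x₁, x₂, x₃, x₄] i = false ∧ ![x₁, x₂, x₃, x₄] j = false)) := by
  refine ⟨fun x₁ x₂ x₃ x₄ => ?_, ?_, ?_⟩
  · have h_one_sub {t : ℝ} (ht : t ∈ Set.Icc (0 : ℝ) 1) : 0 ≤ 1 - t := sub_nonneg.2 ht.2
    have h_rest : 0 ≤ 1 - θ₁ - θ₂ := by linarith
    have := h_one_sub h₃
    have := h_one_sub h₄
    have := h_one_sub h₅
    have := h_one_sub h₆
    have := h_one_sub h₇
    have := h₁.1
    have := h₂.1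
    have := h₃.1
    have := h₄.1
    have := h₅.1
    have := h₆.1
    have := h₇.1
    rw [hF]
    cases x₁ <;> cases x₂ <;> cases x₃ <;> cases x₄ <;>
      simp only [Bool.not_true, Bool.not_false, ind_true, ind_false, mul_one, mul_zero, zero_mul,
        add_zero, zero_add] <;>
      positivity
  · simp only [Fintype.sum_bool, hF, Bool.not_true, Bool.not_false, ind_true, ind_false]
    ring
  · rintro ⟨h₁, h₂, h₃, h₄, h₅, h₆, h₇, h₁₂⟩ x₁ x₂ x₃ x₄
    have h_one_sub {t : ℝ} (ht : t ∈ Set.Ioo (0 : ℝ) 1) : 0 < 1 - t := sub_pos.2 ht.2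
    have h_rest : 0 < 1 - θ₁ - θ₂ := by linarith
    have := h_one_sub h₃
    have := h_one_sub h₄
    have := h_one_sub h₅
    have := h_one_sub h₆
    have := h_one_sub h₇
    have := h₁.1
    have := h₂.1
    have := h₃.1
    have := h₄.1
    have := h₅.1
    have := h₆.1
    have := h₇.1
    rw [hF]
    cases x₁ <;> cases x₂ <;> cases x₃ <;> cases x₄ <;>
      simp only [Bool.not_true, Bool.not_false, ind_true, ind_false, mul_one, mul_zero, zero_mul,
        add_zero, zero_add] <;>
      first
      | exact iff_of_false (lt_irrefl 0) (by decide)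
      | exact iff_of_true (by positivity) (by decide)
end
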